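/- (Lemma 4.2) The cone curvature tensor R̄ satisfies the identity (Ḡ2) if and only if R satisfies all of the identities (G2), (G2-1), (G2-2), (G2-3) and (G2-4). -/

import Mathlib

open scoped RealInnerProductSpace

/-- The almost complex structure `J̄` of the algebraic cone `V × ℝ` over an almost
contact metric structure `(φ, ξ)`: `J̄(X, s) = (φX + sξ, −η(X))`. -/
noncomputable def Jbar {V : Type*} [NormedAddCommGroup V] [InnerProductSpace ℝ V]
    (φ : V →ₗ[ℝ] V) (ξ : V) : V × ℝ → V × ℝ :=
  fun p => (φ p.1 + p.2 • ξ, -⟪ξ, p.1⟫)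

/-- The curvature-like tensor `R̄` of the algebraic cone `V × ℝ`:
`R̄(X̄,Ȳ,Z̄,W̄) = R(X,Y,Z,W) − g(X,W)g(Y,Z) + g(Y,W)g(X,Z)`. -/
noncomputable def Rbar {V : Type*} [NormedAddCommGroup V] [InnerProductSpace ℝ V]
    (R : V →ₗ[ℝ] V →ₗ[ℝ] V →ₗ[ℝ] V →ₗ[ℝ] ℝ) :
    V × ℝ → V × ℝ → V × ℝ → V × ℝ → ℝ :=
  fun X Y Z W =>
    R X.1 Y.1 Z.1 W.1 - ⟪X.1, W.1⟫ * ⟪Y.1, Z.1⟫ + ⟪Y.1, W.1⟫ * ⟪X.1, Z.1⟫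

theorem inner_map_skew {V : Type*} [NormedAddCommGroup V] [InnerProductSpace ℝ V]
    {φ : V →ₗ[ℝ] V} {ξ : V}
    (hφφ : ∀ X : V, φ (φ X) = -X + ⟪ξ, X⟫ • ξ)
    (hηφ : ∀ X : V, ⟪ξ, φ X⟫ = 0)
    (hg : ∀ X Y : V, ⟪φ X, φ Y⟫ = ⟪X, Y⟫ - ⟪ξ, X⟫ * ⟪ξ, Y⟫) (X Y : V) :
    ⟪X, φ Y⟫ = -⟪φ X, Y⟫ := by
  have h := hg X (φ Y)
  rw [hφφ, hηφ, inner_add_right, inner_neg_right, inner_smul_right,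
    real_inner_comm ξ (φ X), hηφ] at h
  linarith

theorem gray2_cone_iff
    {V : Type*} [NormedAddCommGroup V] [InnerProductSpace ℝ V] [FiniteDimensional ℝ V]
    (n : ℕ) (hn : 1 ≤ n) (hdim : Module.finrank ℝ V = 2 * n + 1)
    (φ : V →ₗ[ℝ] V) (ξ : V)
    (hφφ : ∀ X : V, φ (φ X) = -X + ⟪ξ, X⟫ • ξ)
    (hφξ : φ ξ = 0)
    (hηφ : ∀ X : V, ⟪ξ, φ X⟫ = 0)
    (hηξ : ⟪ξ, ξ⟫ = (1 : ℝ))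
    (hg : ∀ X Y : V, ⟪φ X, φ Y⟫ = ⟪X, Y⟫ - ⟪ξ, X⟫ * ⟪ξ, Y⟫)
    (R : V →ₗ[ℝ] V →ₗ[ℝ] V →ₗ[ℝ] V →ₗ[ℝ] ℝ)
    (hskew₁ : ∀ X Y Z W : V, R X Y Z W = - R Y X Z W)
    (hskew₂ : ∀ X Y Z W : V, R X Y Z W = - R X Y W Z)
    (hsymm : ∀ X Y Z W : V, R X Y Z W = R Z W X Y)
    (hbianchi : ∀ X Y Z W : V, R X Y Z W + R Y Z X W + R Z X Y W = 0)
    :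
    (∀ Xb Yb Zb Wb : V × ℝ,
      Rbar R Xb Yb Zb Wb
      = Rbar R (Jbar φ ξ Xb) (Jbar φ ξ Yb) Zb Wb
          + Rbar R (Jbar φ ξ Xb) Yb (Jbar φ ξ Zb) Wb
          + Rbar R (Jbar φ ξ Xb) Yb Zb (Jbar φ ξ Wb))
    ↔
    ((∀ X Y Z W : V,
      R X Y Z W - R (φ X) (φ Y) Z W - R (φ X) Y (φ Z) W - R (φ X) Y Z (φ W)
      = ⟪Y, Z⟫ * ⟪ξ, X⟫ * ⟪ξ, W⟫ - ⟪Y, W⟫ * ⟪ξ, X⟫ * ⟪ξ, Z⟫)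
    ∧ (∀ Y Z W : V, R ξ (φ Y) Z W + R ξ Y (φ Z) W + R ξ Y Z (φ W) = 0)
    ∧ (∀ X Z W : V, R (φ X) ξ Z W = ⟪ξ, Z⟫ * ⟪φ X, W⟫ - ⟪ξ, W⟫ * ⟪φ X, Z⟫)
    ∧ (∀ X Y W : V, R (φ X) Y ξ W = ⟪ξ, Y⟫ * ⟪φ X, W⟫)
    ∧ (∀ Y W : V, R ξ Y ξ W = - ⟪Y, W⟫ + ⟪ξ, Y⟫ * ⟪ξ, W⟫)) := by
  have hskew := inner_map_skew hφφ hηφ hg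
  have hφη (X : V) : ⟪φ X, ξ⟫ = 0 := by rw [real_inner_comm, hηφ]
  have hηr (X : V) : ⟪X, ξ⟫ = ⟪ξ, X⟫ := real_inner_comm _ _
  have hzero (Z W : V) : R ξ ξ Z W = 0 := by linarith [hskew₁ ξ ξ Z W]
  constructor
  · intro h
    refine ⟨fun X Y Z W => ?_, fun Y Z W => ?_, fun X Z W => ?_, fun X Y W => ?_, fun Y W => ?_⟩
    · have key := h (X, 0) (Y, 0) (Z, 0) (W, 0)
      simp only [Rbar, Jbar, zero_smul, add_zero, hg, hskew] at key
      linarith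
    · have key := h (0, 1) (Y, 0) (Z, 0) (W, 0)
      simp only [Rbar, Jbar, zero_smul, one_smul, add_zero, zero_add, map_zero,
        LinearMap.zero_apply, inner_zero_left, hηφ, hskew] at key
      linarith
    · have key := h (X, 0) (0, 1) (Z, 0) (W, 0)
      simp only [Rbar, Jbar, zero_smul, one_smul, add_zero, zero_add, map_zero,
        LinearMap.zero_apply, inner_zero_left] at key
      linarith
    · have key := h (X, 0) (Y, 0) (0, 1) (W, 0)
      simp only [Rbar, Jbar, zero_smul, one_smul, add_zero, zero_add, map_zero,
        LinearMap.zero_apply, inner_zero_right, hφη, hηr] at key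
      linarith
    · have key := h (0, 1) (Y, 0) (0, 1) (W, 0)
      simp only [Rbar, Jbar, zero_smul, one_smul, add_zero, zero_add, map_zero,
        LinearMap.zero_apply, inner_zero_left, inner_zero_right, hηξ, hηr] at key
      linarith
  · rintro ⟨h, h1, h2, h3, h4⟩ ⟨X, x⟩ ⟨Y, y⟩ ⟨Z, z⟩ ⟨W, w⟩
    have h3' : R (φ X) Y Z ξ = -(⟪ξ, Y⟫ * ⟪φ X, Z⟫) := by rw [hskew₂, h3]
    have h4' : R ξ Y Z ξ = -(-⟪Y, Z⟫ + ⟪ξ, Y⟫ * ⟪ξ, Z⟫) := by rw [hskew₂, h4]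
    simp only [Rbar, Jbar, map_add, map_smul, LinearMap.add_apply, LinearMap.smul_apply,
      smul_eq_mul, inner_add_left, inner_add_right, real_inner_smul_left, inner_smul_right,
      inner_neg_left, inner_zero_left, hφφ, hφξ, hηφ, hηr, hηξ, hskew, hzero, h2, h3, h3', h4,
      h4']
    linear_combination h X Y Z W - x * h1 Y Z W
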